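/- arXiv:2405.19863 — 2 statements merged into one kernel-verified Lean document; each statement's English description precedes it below -/
import Mathlib

section
/- Let ξ = (ξ⁰,ξ¹): H → E be an embedding pair. For μ, ν ∈ E^{-∞}, μ ∼_ae ν if and only if μ = ν, or there exist n < 0, edges (y_k)_{k≤n} in H¹ and bits (i_k)_{k≤n}, (i'_k)_{k≤n} in {0,1} with μ_k = ξ^{i_k}(y_k) and ν_k = ξ^{i'_k}(y_k) for all k ≤ n, such that the left-infinite binary sequences (…i_{n-1}i_n) and (…i'_{n-1}i'_n) are asymptotically equivalent for the 2-odometer action of ℤ, and one of the following holds: (1) n = -1; or (2) n ≤ -2, μ_j = ν_j for all j ≥ n+1, and μ_{n+1} = ν_{n+1} ∉ H¹_ξ. -/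
open scoped Classical

/-- An embedding pair `ξ = (ξ⁰,ξ¹) : H → E`: two injective homomorphisms of finite directed
graphs that agree on vertices and have disjoint images on edges. -/
structure EmbPair where
  HV : Type
  HE : Type
  EV : Type
  EE : Type
  finHV : Fintype HV
  finHE : Fintype HE
  finEV : Fintype EV
  finEE : Fintype EE
  rH : HE → HV
  sH : HE → HV
  rE : EE → EV
  sE : EE → EV
  ξV : HV → EV
  ξ0 : HE → EE
  ξ1 : HE → EE
  injV : Function.Injective ξV
  inj0 : Function.Injective ξ0
  inj1 : Function.Injective ξ1
  r0 : ∀ h, rE (ξ0 h) = ξV (rH h)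
  s0 : ∀ h, sE (ξ0 h) = ξV (sH h)
  r1 : ∀ h, rE (ξ1 h) = ξV (rH h)
  s1 : ∀ h, sE (ξ1 h) = ξV (sH h)
  disj : ∀ h h', ξ0 h ≠ ξ1 h'

namespace EmbPair

variable (X : EmbPair)

/-- `H¹_ξ = ξ⁰(H¹) ∪ ξ¹(H¹)`. -/
def Hxi : Set X.EE := Set.range X.ξ0 ∪ Set.range X.ξ1

/-- The action of `(m,v)` on an edge `e` with `r(e) = v`: it fixes `e ∉ H¹_ξ`, and maps
`ξ^i(h)` to `ξ^j(h)` where `m + i = 2n + j`, `j ∈ {0,1}`. -/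
noncomputable def edgeAct (m : ℤ) (e : X.EE) : X.EE :=
  if h0 : ∃ h, X.ξ0 h = e then
    (if m % 2 = 0 then X.ξ0 h0.choose else X.ξ1 h0.choose)
  else if h1 : ∃ h, X.ξ1 h = e then
    (if (m + 1) % 2 = 0 then X.ξ0 h1.choose else X.ξ1 h1.choose)
  else e

/-- The restriction of `(m,v)` along an edge `e` with `r(e) = v`: it is `0` when
`e ∉ H¹_ξ`, and `n` with `m + i = 2n + j`, `j ∈ {0,1}`, when `e = ξ^i(h)`. -/
noncomputable def edgeRes (m : ℤ) (e : X.EE) : ℤ :=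
  if _ : ∃ h, X.ξ0 h = e then m / 2
  else if _ : ∃ h, X.ξ1 h = e then (m + 1) / 2
  else 0

/-- Action on finite paths: `(m,v)·(eν) = ((m,v)·e)((m,v)|_e·ν)`. -/
noncomputable def act : ℤ → List X.EE → List X.EE
  | _, [] => []
  | m, e :: ν => X.edgeAct m e :: act (X.edgeRes m e) ν

/-- Restriction along finite paths: `(m,v)|_{eν} = ((m,v)|_e)|_ν`. -/
noncomputable def res : ℤ → List X.EE → ℤ
  | m, [] => m
  | m, e :: ν => res (X.edgeRes m e) ν

/-- A finite path in `E`. -/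
def IsPath (μ : List X.EE) : Prop := μ.Chain' (fun e f => X.sE e = X.rE f)

/-- `r(μ) = v` (vacuously true for the empty path). -/
def rangeIs (μ : List X.EE) (v : X.EV) : Prop := ∀ e ∈ μ.head?, X.rE e = v

/-- The source of a path with range `v`. -/
def src (v : X.EV) (μ : List X.EE) : X.EV := (μ.getLast?).elim v X.sE

/-- A left-infinite path `⋯μ₋₂μ₋₁` in `E`; index `p : ℕ` encodes position `-(p+1)`. -/
def IsLPath (μ : ℕ → X.EE) : Prop := ∀ n, X.sE (μ (n + 1)) = X.rE (μ n)

/-- The finite segment `μ₋ₖ⋯μ₋₁` of a left-infinite path. -/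
def seg (μ : ℕ → X.EE) (k : ℕ) : List X.EE := ((List.range k).reverse).map μ

/-- Asymptotic equivalence of left-infinite paths in `E`. -/
def AsympEquiv (μ ν : ℕ → X.EE) : Prop :=
  ∃ F : Finset ℤ, ∃ g : ℕ → ℤ, ∀ n : ℕ,
    g n ∈ F ∧ X.rE (μ n) = X.rE (ν n) ∧ X.act (g n) (X.seg μ (n + 1)) = X.seg ν (n + 1)

/-- `ξ^b` for a bit `b`. -/
def xiB (b : Bool) : X.HE → X.EE := fun h => bif b then X.ξ1 h else X.ξ0 h

end EmbPair

/-- The binary odometer action of `a^m` on finite binary words (head bit acted on first):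
`a^m·(i w) = j (a^n·w)` where `m + i = 2n + j`, `j ∈ {0,1}`. -/
def odoAct : ℤ → List Bool → List Bool
  | _, [] => []
  | m, b :: w =>
      decide ((m + (bif b then 1 else 0)) % 2 = 1) ::
        odoAct ((m + (bif b then 1 else 0)) / 2) w

/-- The segment `x₋ₖ⋯x₋₁` of a left-infinite binary sequence (index `p ↦` position
`-(p+1)`). -/
def bseg (x : ℕ → Bool) (k : ℕ) : List Bool := ((List.range k).reverse).map x

/-- Asymptotic equivalence of left-infinite binary sequences for the 2-odometer action. -/
def odoAE (x x' : ℕ → Bool) : Prop :=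
  ∃ F : Finset ℤ, ∃ g : ℕ → ℤ, ∀ k : ℕ,
    g k ∈ F ∧ odoAct (g k) (bseg x (k + 1)) = bseg x' (k + 1)

namespace EmbPair

variable (X : EmbPair)

theorem xiB_inj {b b' : Bool} {h h' : X.HE} : X.xiB b h = X.xiB b' h' ↔ b = b' ∧ h = h' := by
  cases b <;> cases b' <;>
    simp [xiB, X.inj0.eq_iff, X.inj1.eq_iff, X.disj, fun h h' => (X.disj h h').symm]

theorem mem_Hxi {e : X.EE} : e ∈ X.Hxi ↔ ∃ b h, e = X.xiB b h := by
  simp [Hxi, xiB, eq_comm]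

theorem edgeAct_xiB (m : ℤ) (b : Bool) (h : X.HE) :
    X.edgeAct m (X.xiB b h) = X.xiB (decide ((m + (bif b then 1 else 0)) % 2 = 1)) h := by
  cases b
  · have h0 : ∃ k, X.ξ0 k = X.ξ0 h := ⟨h, rfl⟩
    have hc : h0.choose = h := X.inj0 h0.choose_spec
    rcases Int.emod_two_eq_zero_or_one m with hm | hm <;> simp [edgeAct, xiB, hc, hm]
  · have h0 : ¬ ∃ k, X.ξ0 k = X.ξ1 h := fun ⟨k, hk⟩ => X.disj _ _ hk
    have h1 : ∃ k, X.ξ1 k = X.ξ1 h := ⟨h, rfl⟩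
    have hc : h1.choose = h := X.inj1 h1.choose_spec
    rcases Int.emod_two_eq_zero_or_one (m + 1) with hm | hm <;>
      simp only [edgeAct, xiB, cond_true, dif_neg h0, dif_pos h1, hc, hm] <;> simp

theorem edgeRes_xiB (m : ℤ) (b : Bool) (h : X.HE) :
    X.edgeRes m (X.xiB b h) = (m + (bif b then 1 else 0)) / 2 := by
  cases b
  · simp [edgeRes, xiB]
  · simp [edgeRes, xiB, X.disj]

theorem edgeAct_of_notMem {e : X.EE} (he : e ∉ X.Hxi) (m : ℤ) : X.edgeAct m e = e := by
  simp only [Hxi, Set.mem_union, Set.mem_range, not_or] at he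
  rw [edgeAct, dif_neg he.1, dif_neg he.2]

theorem edgeRes_of_notMem {e : X.EE} (he : e ∉ X.Hxi) (m : ℤ) : X.edgeRes m e = 0 := by
  simp only [Hxi, Set.mem_union, Set.mem_range, not_or] at he
  rw [edgeRes, dif_neg he.1, dif_neg he.2]

theorem edgeAct_zero (e : X.EE) : X.edgeAct 0 e = e := by
  by_cases he : e ∈ X.Hxi
  · obtain ⟨b, h, rfl⟩ := X.mem_Hxi.1 he
    rw [edgeAct_xiB]
    cases b <;> simp
  · exact X.edgeAct_of_notMem he 0

theorem edgeRes_zero (e : X.EE) : X.edgeRes 0 e = 0 := by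
  by_cases he : e ∈ X.Hxi
  · obtain ⟨b, h, rfl⟩ := X.mem_Hxi.1 he
    rw [edgeRes_xiB]
    cases b <;> simp
  · exact X.edgeRes_of_notMem he 0

theorem act_zero (l : List X.EE) : X.act 0 l = l := by
  induction l with
  | nil => rfl
  | cons e l ih => rw [act, edgeAct_zero, edgeRes_zero, ih]

theorem act_cons_of_notMem {e : X.EE} (he : e ∉ X.Hxi) (m : ℤ) (l : List X.EE) :
    X.act m (e :: l) = e :: l := by
  rw [act, X.edgeAct_of_notMem he, X.edgeRes_of_notMem he, act_zero]

theorem length_act (m : ℤ) (l : List X.EE) : (X.act m l).length = l.length := by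
  induction l generalizing m with
  | nil => rfl
  | cons e l ih => simp [act, ih]

theorem act_append (m : ℤ) (l l' : List X.EE) :
    X.act m (l ++ l') = X.act m l ++ X.act (X.res m l) l' := by
  induction l generalizing m with
  | nil => rfl
  | cons e l ih => simp [act, res, ih]

theorem act_map_xiB_iff (y : ℕ → X.HE) (i i' : ℕ → Bool) (l : List ℕ) (m : ℤ) :
    X.act m (l.map fun p => X.xiB (i p) (y p)) = (l.map fun p => X.xiB (i' p) (y p)) ↔
      odoAct m (l.map i) = l.map i' := by
  induction l generalizing m with
  | nil => simp [act, odoAct]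
  | cons p l ih =>
    simp only [List.map_cons, act, odoAct, List.cons.injEq, edgeAct_xiB, edgeRes_xiB, xiB_inj,
      and_true, ih]

theorem seg_succ (μ : ℕ → X.EE) (k : ℕ) : X.seg μ (k + 1) = μ k :: X.seg μ k := by
  simp [seg, List.range_succ]

theorem seg_add (μ : ℕ → X.EE) (n k : ℕ) :
    X.seg μ (n + k) = X.seg (fun q => μ (n + q)) k ++ X.seg μ n := by
  simp [seg, List.range_add, Function.comp_def]

theorem length_seg (μ : ℕ → X.EE) (k : ℕ) : (X.seg μ k).length = k := by
  simp [seg]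

theorem seg_eq_seg_iff {μ ν : ℕ → X.EE} {k : ℕ} :
    X.seg μ k = X.seg ν k ↔ ∀ p < k, μ p = ν p := by
  simp [seg, List.map_inj_left]

theorem act_seg_xiB_iff {μ ν : ℕ → X.EE} {y : ℕ → X.HE} {i i' : ℕ → Bool}
    (hμ : ∀ p, μ p = X.xiB (i p) (y p)) (hν : ∀ p, ν p = X.xiB (i' p) (y p)) (m : ℤ) (k : ℕ) :
    X.act m (X.seg μ k) = X.seg ν k ↔ odoAct m (bseg i k) = bseg i' k := by
  obtain rfl : μ = _ := funext hμ
  obtain rfl : ν = _ := funext hν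
  exact X.act_map_xiB_iff y i i' _ m

theorem rE_xiB (b : Bool) (h : X.HE) : X.rE (X.xiB b h) = X.ξV (X.rH h) := by
  cases b
  · exact X.r0 h
  · exact X.r1 h

/-- Where `μ` leaves `H¹_ξ`, all group elements act trivially from there on. -/
theorem eq_of_act_seg_eq {μ ν : ℕ → X.EE} {p : ℕ} (hp : μ p ∉ X.Hxi) {m : ℤ}
    (h : X.act m (X.seg μ (p + 1)) = X.seg ν (p + 1)) : ∀ q ≤ p, μ q = ν q := by
  rw [seg_succ, X.act_cons_of_notMem hp, ← seg_succ, seg_eq_seg_iff] at h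
  exact fun q hq => h q (Nat.lt_succ_of_le hq)

/-- Past position `n`, asymptotically equivalent paths in `H¹_ξ` have the same edges of `H`
and asymptotically equivalent bits. -/
theorem exists_bits_of_act {μ ν : ℕ → X.EE} {n : ℕ} (hmem : ∀ p, n ≤ p → μ p ∈ X.Hxi)
    {F : Finset ℤ} {g : ℕ → ℤ}
    (hg : ∀ k, g k ∈ F ∧ X.act (g k) (X.seg μ (k + 1)) = X.seg ν (k + 1)) :
    ∃ y : ℕ → X.HE, ∃ i i' : ℕ → Bool,
      (∀ p : ℕ, n ≤ p → μ p = X.xiB (i p) (y p) ∧ ν p = X.xiB (i' p) (y p)) ∧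
        odoAE (fun q => i (n + q)) (fun q => i' (n + q)) := by
  have hex : ∀ q, ∃ y i i', μ (n + q) = X.xiB i y ∧ ν (n + q) = X.xiB i' y := by
    intro q
    obtain ⟨b, y, hb⟩ := X.mem_Hxi.1 (hmem (n + q) (Nat.le_add_right _ _))
    have h := (hg (n + q)).2
    rw [seg_succ, seg_succ, act, List.cons.injEq, hb, edgeAct_xiB] at h
    exact ⟨y, b, _, hb, h.1.symm⟩
  choose y i i' hμ hν using hex
  refine ⟨fun p => y (p - n), fun p => i (p - n), fun p => i' (p - n), fun p hp => ?_,
    F, fun k => g (n + k), fun k => ⟨(hg _).1, ?_⟩⟩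
  · have h1 := hμ (p - n)
    have h2 := hν (p - n)
    rw [Nat.add_sub_cancel' hp] at h1 h2
    exact ⟨h1, h2⟩
  · have h := (hg (n + k)).2
    rw [Nat.add_assoc, X.seg_add μ n (k + 1), X.seg_add ν n (k + 1), act_append] at h
    have hk := (List.append_inj h (by simp [length_act, length_seg])).1
    simpa using (X.act_seg_xiB_iff hμ hν _ _).1 hk

/-- A path decomposition with asymptotically equivalent bits past position `n`, agreeing after
an edge outside `H¹_ξ`, gives asymptotically equivalent paths. -/
theorem asympEquiv_of_bits {μ ν : ℕ → X.EE} {n : ℕ} {y : ℕ → X.HE} {i i' : ℕ → Bool}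
    (hy : ∀ p : ℕ, n ≤ p → μ p = X.xiB (i p) (y p) ∧ ν p = X.xiB (i' p) (y p))
    (hae : odoAE (fun q => i (n + q)) (fun q => i' (n + q)))
    (hn : ∀ p < n, μ p = ν p) (hlast : ∀ p, n = p + 1 → μ p ∉ X.Hxi) :
    X.AsympEquiv μ ν := by
  obtain ⟨F, g, hg⟩ := hae
  refine ⟨insert 0 F, fun k => if n ≤ k then g (k - n) else 0, fun k => ⟨?_, ?_, ?_⟩⟩
  · dsimp only
    split_ifs
    · exact Finset.mem_insert_of_mem (hg _).1
    · exact Finset.mem_insert_self _ _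
  · rcases le_or_gt n k with h | h
    · rw [(hy k h).1, (hy k h).2, rE_xiB, rE_xiB]
    · rw [hn k h]
  · dsimp only
    split_ifs with h
    · obtain ⟨q, rfl⟩ := Nat.exists_eq_add_of_le h
      rw [Nat.add_sub_cancel_left, Nat.add_assoc, X.seg_add μ n (q + 1), X.seg_add ν n (q + 1),
        act_append,
        (X.act_seg_xiB_iff (μ := fun q => μ (n + q)) (ν := fun q => ν (n + q))
          (fun q => (hy (n + q) (Nat.le_add_right _ _)).1)
          (fun q => (hy (n + q) (Nat.le_add_right _ _)).2) _ _).2 (hg q).2,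
        ← X.seg_eq_seg_iff.2 hn]
      cases n with
      | zero => rfl
      | succ p => rw [X.seg_succ μ p, X.act_cons_of_notMem (hlast p rfl)]
    · rw [act_zero, seg_eq_seg_iff]
      exact fun p hp => hn p (by omega)

end EmbPair


open EmbPair in
/-- characterisation of asymptotic equivalence for the self-similar
groupoid of an embedding pair, in terms of 2-odometer asymptotic equivalence of the
binary sequences of embedding choices. Positions: `n = -(n'+1)`. -/
theorem statement14 (X : EmbPair) (μ ν : ℕ → X.EE) (hμ : X.IsLPath μ) (hν : X.IsLPath ν) :
    X.AsympEquiv μ ν ↔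
      (μ = ν ∨ ∃ n' : ℕ, ∃ y : ℕ → X.HE, ∃ i i' : ℕ → Bool,
        (∀ p : ℕ, n' ≤ p → μ p = X.xiB (i p) (y p) ∧ ν p = X.xiB (i' p) (y p)) ∧
        odoAE (fun q => i (n' + q)) (fun q => i' (n' + q)) ∧
        (n' = 0 ∨
          (1 ≤ n' ∧ (∀ p : ℕ, p < n' → μ p = ν p) ∧ μ (n' - 1) ∉ X.Hxi))) := by
  constructor
  · rintro ⟨F, g, hg⟩
    have hact : ∀ k, g k ∈ F ∧ X.act (g k) (X.seg μ (k + 1)) = X.seg ν (k + 1) :=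
      fun k => ⟨(hg k).1, (hg k).2.2⟩
    by_cases hinf : ∀ n, ∃ p, n ≤ p ∧ μ p ∉ X.Hxi
    · refine Or.inl (funext fun q => ?_)
      obtain ⟨p, hqp, hp⟩ := hinf q
      exact X.eq_of_act_seg_eq hp (hact p).2 q hqp
    · right
      push Not at hinf
      obtain ⟨y, i, i', hy, hae⟩ := X.exists_bits_of_act (Nat.find_spec hinf) hact
      refine ⟨Nat.find hinf, y, i, i', hy, hae, ?_⟩
      rcases Nat.eq_zero_or_pos (Nat.find hinf) with h0 | h0
      · exact Or.inl h0
      · have hlast : μ (Nat.find hinf - 1) ∉ X.Hxi := fun hmem =>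
          Nat.find_min hinf (Nat.sub_one_lt_of_lt h0) fun p hp => by
            rcases hp.eq_or_lt with rfl | hp
            · exact hmem
            · exact Nat.find_spec hinf p (by omega)
        exact Or.inr ⟨h0, fun p hp =>
          X.eq_of_act_seg_eq hlast (hact _).2 p (Nat.le_sub_one_of_lt hp), hlast⟩
  · rintro (rfl | ⟨n, y, i, i', hy, hae, rfl | ⟨-, hn, hlast⟩⟩)
    · exact ⟨{0}, fun _ => 0, fun _ => ⟨Finset.mem_singleton_self _, rfl, X.act_zero _⟩⟩
    · exact X.asympEquiv_of_bits hy hae (by simp) (by simp)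
    · refine X.asympEquiv_of_bits hy hae hn ?_
      rintro p rfl
      exact hlast
end

section
/- Let (A,B) be a Katsura pair with B ∈ M_N({0,1}). For left-infinite paths μ, ν of E_A, define μ ∼_e ν if there are integers (k_n)_{n<0} with r(μ_n) = r(ν_n) and a^{k_n}·(μ_n⋯μ_{-1}) = ν_n⋯ν_{-1} for all n < 0. Then μ ∼_e ν if and only if μ = ν, or there is K ≤ -1 such that s(μ_k) = s(ν_k) and B(μ_k) = 1 for all k ≤ K, and either K = -1, or (μ_j = ν_j for all j ≥ K+1 and B(μ_{K+1}) = 0). -/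
open scoped Classical

/-- A Katsura pair on a vertex set `V`: matrices `A` (natural entries) and `B` (integer
entries) with `A i j = 0 → B i j = 0`. -/
structure KatsuraPair (V : Type) where
  A : V → V → ℕ
  B : V → V → ℤ
  zero : ∀ i j, A i j = 0 → B i j = 0

namespace KatsuraPair

variable {V : Type}

/-- An edge `e_{i,j,m}` (with `0 ≤ m < A i j`) of the graph `E_A`; the range is `i` and the
source is `j`. -/
structure Edge (P : KatsuraPair V) where
  i : V
  j : V
  m : ℕ
  hm : m < P.A i j

variable {P : KatsuraPair V}

/-- A finite path `μ = μ₁⋯μₙ`: consecutive edges satisfy `s(μₜ) = r(μₜ₊₁)`. -/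
def IsPath (μ : List (Edge P)) : Prop := μ.Chain' (fun e f => e.j = f.i)

/-- `r(μ) = v` (vacuously true for the empty path, viewed as a vertex). -/
def rangeIs (μ : List (Edge P)) (v : V) : Prop := ∀ e ∈ μ.head?, e.i = v

/-- The source of a path whose range is `v` (so `s` of the empty path at `v` is `v`). -/
def src (v : V) (μ : List (Edge P)) : V := (μ.getLast?).elim v (fun e => e.j)

/-- `A_μ`, the product of the `A`-entries along `μ` (empty product is 1). -/
def Aprod (μ : List (Edge P)) : ℕ := (μ.map (fun e => P.A e.i e.j)).prod

/-- `B_μ`, the product of the `B`-entries along `μ` (empty product is 1). -/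
def Bprod (μ : List (Edge P)) : ℤ := (μ.map (fun e => P.B e.i e.j)).prod

/-- `a^k · e_{i,j,m} = e_{i,j,m̂}` where `k·B i j + m = k̂·(A i j) + m̂`, `0 ≤ m̂ < A i j`. -/
def edgeAct (k : ℤ) (e : Edge P) : Edge P where
  i := e.i
  j := e.j
  m := ((k * P.B e.i e.j + (e.m : ℤ)) % (P.A e.i e.j : ℤ)).toNat
  hm := by
    have hA : 0 < P.A e.i e.j := Nat.lt_of_le_of_lt (Nat.zero_le _) e.hm
    have hA' : (0 : ℤ) < (P.A e.i e.j : ℤ) := by exact_mod_cast hA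
    have h1 : 0 ≤ (k * P.B e.i e.j + (e.m : ℤ)) % (P.A e.i e.j : ℤ) :=
      Int.emod_nonneg _ hA'.ne'
    have h2 : (k * P.B e.i e.j + (e.m : ℤ)) % (P.A e.i e.j : ℤ) < (P.A e.i e.j : ℤ) :=
      Int.emod_lt_of_pos _ hA'
    omega

/-- `a^k|_{e_{i,j,m}} = a^{k̂}` where `k·B i j + m = k̂·(A i j) + m̂`, `0 ≤ m̂ < A i j`. -/
def edgeRes (k : ℤ) (e : Edge P) : ℤ := (k * P.B e.i e.j + (e.m : ℤ)) / (P.A e.i e.j : ℤ)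

/-- The action of `a^k` on finite paths: `a^k · (eν) = (a^k · e)(a^k|_e · ν)`. -/
def act : ℤ → List (Edge P) → List (Edge P)
  | _, [] => []
  | k, e :: ν => edgeAct k e :: act (edgeRes k e) ν

/-- The restriction along a path: `a^k|_{eν} = (a^k|_e)|_ν`; `res k μ` is the integer with
`a^k|_μ = a^{res k μ}`. -/
def res : ℤ → List (Edge P) → ℤ
  | k, [] => k
  | k, e :: ν => res (edgeRes k e) ν

/-- `a^k` and `a^l` act equally at the vertex `v`. -/
def ActEq (P : KatsuraPair V) (k l : ℤ) (v : V) : Prop :=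
  ∀ μ : List (Edge P), IsPath μ → rangeIs μ v → act k μ = act l μ

/-- The KEP-action `(G_B, E_A)` is contracting. -/
def Contracting (P : KatsuraPair V) : Prop :=
  ∃ F : Finset ℤ, ∀ k : ℤ, ∀ v : V, ∃ n : ℕ, ∀ μ : List (Edge P),
    IsPath μ → rangeIs μ v → n ≤ μ.length →
    ∃ l ∈ F, ActEq P (res k μ) l (src v μ)

/-- The KEP-action `(G_B, E_A)` is regular. -/
def Regular (P : KatsuraPair V) : Prop :=
  ∀ k : ℤ, ∀ v : V, ∃ K : ℕ, ∀ μ : List (Edge P),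
    IsPath μ → rangeIs μ v → K ≤ μ.length → act k μ = μ →
    ActEq P (res k μ) 0 (src v μ)

/-- `v ∈ E⁰_{A,<∞}`: the quantity `A_μ / gcd(A_μ, |B_μ|)` is bounded over paths `μ` with
range `v` and `B_μ ≠ 0`. -/
def FiniteVertex (P : KatsuraPair V) (v : V) : Prop :=
  ∃ C : ℕ, ∀ μ : List (Edge P), IsPath μ → rangeIs μ v → Bprod μ ≠ 0 →
    Aprod μ / Nat.gcd (Aprod μ) (Bprod μ).natAbs ≤ C

/-- An edge of `E_{A,∞}`: `B` nonzero and source in `E⁰_{A,∞}`. -/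
def InfEdge (e : Edge P) : Prop := P.B e.i e.j ≠ 0 ∧ ¬ FiniteVertex P e.j

/-- An edge of `E_{A,<∞}`: `B` nonzero and range in `E⁰_{A,<∞}`. -/
def FinEdge (e : Edge P) : Prop := P.B e.i e.j ≠ 0 ∧ FiniteVertex P e.i

/-- The infinite part `(A_∞, B_∞)` of a Katsura pair. -/
def infinitePart (P : KatsuraPair V) : KatsuraPair {v : V // ¬ FiniteVertex P v} where
  A := fun i j => if P.B i.1 j.1 = 0 then 0 else P.A i.1 j.1
  B := fun i j => P.B i.1 j.1
  zero := fun i j h => by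
    by_cases hb : P.B i.1 j.1 = 0
    · exact hb
    · simp only [if_neg hb] at h
      exact P.zero _ _ h

/-- The finite part `(A_{<∞}, B_{<∞})` of a Katsura pair. -/
def finitePart (P : KatsuraPair V) : KatsuraPair {v : V // FiniteVertex P v} where
  A := fun i j => if P.B i.1 j.1 = 0 then 0 else P.A i.1 j.1
  B := fun i j => P.B i.1 j.1
  zero := fun i j h => by
    by_cases hb : P.B i.1 j.1 = 0
    · exact hb
    · simp only [if_neg hb] at h
      exact P.zero _ _ h

end KatsuraPair

namespace KatsuraPair

variable {V : Type} {P : KatsuraPair V}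

/-- A left-infinite path `⋯μ₋₂μ₋₁`; index `p : ℕ` encodes position `-(p+1)`. -/
def IsLPath (μ : ℕ → Edge P) : Prop := ∀ n, (μ (n + 1)).j = (μ n).i

/-- The finite segment `μ₋ₖ⋯μ₋₁` of a left-infinite path. -/
def seg (μ : ℕ → Edge P) (k : ℕ) : List (Edge P) := ((List.range k).reverse).map μ

/-- Asymptotic equivalence of left-infinite paths: implementing groupoid elements lie in a
finite set `F ⊆ ℤ`. -/
def AsympEquiv (μ ν : ℕ → Edge P) : Prop :=
  ∃ F : Finset ℤ, ∃ g : ℕ → ℤ, ∀ n : ℕ,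
    g n ∈ F ∧ (μ n).i = (ν n).i ∧ act (g n) (seg μ (n + 1)) = seg ν (n + 1)

end KatsuraPair

namespace KatsuraPair

variable {V : Type} {P : KatsuraPair V}

/-- The relation `∼ₑ`: like asymptotic equivalence but with no finiteness requirement on
the implementing sequence of groupoid elements. -/
def EquivE (μ ν : ℕ → Edge P) : Prop :=
  ∃ g : ℕ → ℤ, ∀ n : ℕ,
    (μ n).i = (ν n).i ∧ act (g n) (seg μ (n + 1)) = seg ν (n + 1)

end KatsuraPair

namespace KatsuraPair

variable {V : Type} {P : KatsuraPair V}

theorem Edge.A_pos (e : Edge P) : 0 < P.A e.i e.j :=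
  (Nat.zero_le _).trans_lt e.hm

theorem Edge.m_div (e : Edge P) : (e.m : ℤ) / (P.A e.i e.j : ℤ) = 0 :=
  Int.ediv_eq_zero_of_lt (by positivity) (by exact_mod_cast e.hm)

theorem Edge.m_mod (e : Edge P) : (e.m : ℤ) % (P.A e.i e.j : ℤ) = e.m :=
  Int.emod_eq_of_lt (by positivity) (by exact_mod_cast e.hm)

theorem Edge.eq_of_fields {e f : Edge P} (hi : e.i = f.i) (hj : e.j = f.j) (hm : e.m = f.m) :
    e = f := by
  cases e; cases f; simp_all

theorem edgeRes_of_mul_eq_zero {k : ℤ} {e : Edge P} (h : k * P.B e.i e.j = 0) :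
    edgeRes k e = 0 := by
  simp [edgeRes, h, e.m_div]

theorem edgeAct_of_mul_eq_zero {k : ℤ} {e : Edge P} (h : k * P.B e.i e.j = 0) :
    edgeAct k e = e :=
  Edge.eq_of_fields rfl rfl (by simp [edgeAct, h, e.m_mod])

theorem act_zero (μ : List (Edge P)) : act 0 μ = μ := by
  induction μ with
  | nil => rfl
  | cons e μ ih =>
    rw [act, edgeAct_of_mul_eq_zero (zero_mul _), edgeRes_of_mul_eq_zero (zero_mul _), ih]

/-- Along an edge with `B = 1` the action is an odometer: any parallel edge and any
restriction can be reached simultaneously. -/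
theorem exists_edgeAct_edgeRes {e f : Edge P} (hi : e.i = f.i) (hj : e.j = f.j)
    (hB : P.B e.i e.j = 1) (l : ℤ) : ∃ k : ℤ, edgeAct k e = f ∧ edgeRes k e = l := by
  have hA : (P.A e.i e.j : ℤ) ≠ 0 := by exact_mod_cast e.A_pos.ne'
  have hsum : ((f.m : ℤ) + l * P.A e.i e.j - e.m) * P.B e.i e.j + e.m
      = f.m + l * P.A e.i e.j := by rw [hB]; ring
  refine ⟨f.m + l * P.A e.i e.j - e.m, Edge.eq_of_fields hi hj ?_, ?_⟩
  · simp only [edgeAct, hsum, Int.add_mul_emod_self_right]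
    rw [hi, hj, f.m_mod, Int.toNat_natCast]
  · rw [edgeRes, hsum, Int.add_mul_ediv_right _ _ hA, hi, hj, f.m_div, zero_add]

theorem seg_succ (μ : ℕ → Edge P) (n : ℕ) : seg μ (n + 1) = μ n :: seg μ n := by
  simp [seg, List.range_succ]

theorem seg_eq_iff {μ ν : ℕ → Edge P} {n : ℕ} :
    seg μ n = seg ν n ↔ ∀ p < n, μ p = ν p := by
  simp [seg]

theorem source_eq_of_act_seg_eq {μ ν : ℕ → Edge P} {n : ℕ} {k : ℤ}
    (h : act k (seg μ (n + 1)) = seg ν (n + 1)) : (μ n).j = (ν n).j := by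
  simp only [seg_succ, act, List.cons.injEq] at h
  exact h.1 ▸ rfl

/-- If `a^k` carries one segment to another, the two agree from any edge with `B = 0` on. -/
theorem eq_of_act_seg_eq {μ ν : ℕ → Edge P} {n : ℕ} {k : ℤ}
    (h : act k (seg μ (n + 1)) = seg ν (n + 1)) (hB : P.B (μ n).i (μ n).j = 0) :
    ∀ p < n + 1, μ p = ν p := by
  have h0 : k * P.B (μ n).i (μ n).j = 0 := by rw [hB, mul_zero]
  rw [← seg_eq_iff, ← h, seg_succ, act, edgeAct_of_mul_eq_zero h0, edgeRes_of_mul_eq_zero h0,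
    act_zero]

theorem exists_act_seg_eq {μ ν : ℕ → Edge P} {K : ℕ} (hi : ∀ p, (μ p).i = (ν p).i)
    (h : ∀ p, K ≤ p → (μ p).j = (ν p).j ∧ P.B (μ p).i (μ p).j = 1)
    (hlt : ∀ p < K, μ p = ν p) (n : ℕ) : ∃ k : ℤ, act k (seg μ n) = seg ν n := by
  induction n with
  | zero => exact ⟨0, rfl⟩
  | succ n ih =>
    rcases lt_or_ge n K with hn | hn
    · exact ⟨0, by rw [act_zero, seg_eq_iff]; exact fun p hp => hlt p (by omega)⟩
    · obtain ⟨l, hl⟩ := ih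
      obtain ⟨k, hk, hr⟩ := exists_edgeAct_edgeRes (hi n) (h n hn).1 (h n hn).2 l
      exact ⟨k, by rw [seg_succ, seg_succ, act, hk, hr, hl]⟩

end KatsuraPair

open KatsuraPair in
/-- for a Katsura pair with `B ∈ M_N({0,1})` and left-infinite paths `μ, ν`,
`μ ∼ₑ ν` iff `μ = ν` or there is a position `K ≤ -1` (encoded by the index `K' = -K-1 ∈ ℕ`)
with `s(μ_k) = s(ν_k)` and `B(μ_k) = 1` for all `k ≤ K`, and either `K = -1`, or
(`μ_j = ν_j` for all `j ≥ K+1` and `B(μ_{K+1}) = 0`). -/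
theorem statement17 (N : ℕ) (hN : 0 < N) (P : KatsuraPair (Fin N))
    (hB : ∀ i j, P.B i j = 0 ∨ P.B i j = 1)
    (μ ν : ℕ → Edge P) (hμ : IsLPath μ) (hν : IsLPath ν) :
    EquivE μ ν ↔
      (μ = ν ∨ ∃ K' : ℕ,
        (∀ p : ℕ, K' ≤ p → (μ p).j = (ν p).j ∧ P.B (μ p).i (μ p).j = 1) ∧
        (K' = 0 ∨ (1 ≤ K' ∧ (∀ p : ℕ, p < K' → μ p = ν p) ∧
          P.B (μ (K' - 1)).i (μ (K' - 1)).j = 0))) := by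
  constructor
  · rintro ⟨g, hg⟩
    have hj : ∀ p, (μ p).j = (ν p).j := fun p => source_eq_of_act_seg_eq (hg p).2
    by_cases hex : ∃ K, ∀ p, K ≤ p → P.B (μ p).i (μ p).j = 1
    · right
      refine ⟨Nat.find hex, fun p hp => ⟨hj p, Nat.find_spec hex p hp⟩, ?_⟩
      refine (Nat.eq_zero_or_pos _).imp_right fun hpos => ?_
      have hzero : P.B (μ (Nat.find hex - 1)).i (μ (Nat.find hex - 1)).j = 0 := by
        refine (hB _ _).resolve_right fun hone => ?_
        refine Nat.find_min hex (Nat.sub_lt hpos one_pos) fun p hp => ?_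
        rcases hp.eq_or_lt with rfl | hlt
        · exact hone
        · exact Nat.find_spec hex p (by omega)
      exact ⟨hpos, fun p hp => eq_of_act_seg_eq (hg _).2 hzero p (by omega), hzero⟩
    · left
      push Not at hex
      funext q
      obtain ⟨p, hqp, hp⟩ := hex q
      exact eq_of_act_seg_eq (hg p).2 ((hB _ _).resolve_right hp) q (by omega)
  · rintro (rfl | ⟨K, h, hK⟩)
    · exact ⟨0, fun n => ⟨rfl, act_zero _⟩⟩
    · have hlt : ∀ p < K, μ p = ν p := by
        rcases hK with rfl | ⟨-, hlt, -⟩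
        · exact fun p hp => absurd hp (Nat.not_lt_zero p)
        · exact hlt
      have hi : ∀ p, (μ p).i = (ν p).i := by
        intro p
        rcases lt_or_ge p K with hp | hp
        · rw [hlt p hp]
        · rw [← hμ p, ← hν p, (h (p + 1) (by omega)).1]
      choose g hg using exists_act_seg_eq hi h hlt
      exact ⟨fun n => g (n + 1), fun n => ⟨hi n, hg (n + 1)⟩⟩
end
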